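/- Fix an integer ν ≥ 1. There exists a constant C = C(ν) > 0 such that for every integer h ≥ 3 and every irrational number σ ∈ ℂ (i.e., σ ∉ ℚ), one has |K_ν(h,σ) − ν!·h^ν| ≤ h^{ν−1}·exp(C·log h/log log h). -/

import Mathlib

/-- The reference growth function `exp (log h / log log h)`. -/
noncomputable def expLogDivLogLog (h : ℕ) : ℝ :=
  Real.exp (Real.log h / Real.log (Real.log h))

lemma one_lt_log_natCast {h : ℕ} (hh : 3 ≤ h) : 1 < Real.log h := by
  rw [Real.lt_log_iff_exp_lt (by positivity)]
  have : (3 : ℝ) ≤ h := by exact_mod_cast hh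
  linarith [Real.exp_one_lt_d9]

lemma two_le_expLogDivLogLog {h : ℕ} (hh : 3 ≤ h) : 2 ≤ expLogDivLogLog h := by
  have h1 := one_lt_log_natCast hh
  have h2 : 0 < Real.log (Real.log h) := Real.log_pos h1
  have h3 : 1 ≤ Real.log h / Real.log (Real.log h) := by
    rw [le_div_iff₀ h2]
    linarith [Real.log_le_sub_one_of_pos (show (0 : ℝ) < Real.log h by linarith)]
  have := Real.add_one_le_exp (Real.log h / Real.log (Real.log h))
  unfold expLogDivLogLog
  linarith

lemma natCast_le_expLogDivLogLog_pow {h : ℕ} (hh : 3 ≤ h) (n : ℕ) :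
    (n : ℝ) ≤ expLogDivLogLog h ^ n :=
  calc (n : ℝ) ≤ 2 ^ n := by exact_mod_cast Nat.lt_two_pow_self.le
    _ ≤ _ := pow_le_pow_left₀ (by norm_num) (two_le_expLogDivLogLog hh) n

lemma log_card_divisors_le {n : ℕ} (hn : n ≠ 0) {z c : ℝ} (hz : 1 < z)
    (hc : Real.log n / Real.log 2 ≤ c) :
    Real.log n.divisors.card ≤
      z * Real.log (1 + c) + Real.log 2 * (Real.log n / Real.log z) := by
  have hlz : 0 < Real.log z := Real.log_pos hz
  have hl2 : 0 < Real.log 2 := Real.log_pos (by norm_num)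
  have hn1 : 0 ≤ Real.log n := Real.log_natCast_nonneg n
  have hc0 : 0 ≤ c := le_trans (by positivity) hc
  have hlc : 0 ≤ Real.log (1 + c) := Real.log_nonneg (by linarith)
  have hsum : Real.log n = ∑ p ∈ n.primeFactors, n.factorization p * Real.log p := by
    rw [Real.log_nat_eq_sum_factorization]; rfl
  rw [Nat.card_divisors hn]
  push_cast
  rw [Real.log_prod (fun p _ => by positivity)]
  have key : ∀ p ∈ n.primeFactors, Real.log ((n.factorization p : ℝ) + 1) ≤
      (if (p : ℝ) ≤ z then Real.log (1 + c) else 0) +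
        Real.log 2 / Real.log z * (n.factorization p * Real.log p) := by
    intro p hp
    have hpp := Nat.prime_of_mem_primeFactors hp
    have hp2 : (2 : ℝ) ≤ p := by exact_mod_cast hpp.two_le
    have hlp : Real.log 2 ≤ Real.log p := Real.log_le_log (by norm_num) hp2
    split_ifs with h
    · have h1 : (n.factorization p : ℝ) * Real.log p ≤ Real.log n := by
        rw [hsum]
        exact Finset.single_le_sum
          (f := fun p : ℕ => (n.factorization p : ℝ) * Real.log p)
          (fun i _ => mul_nonneg (by positivity) (Real.log_natCast_nonneg i)) hp
      have h2 : (n.factorization p : ℝ) ≤ c := by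
        refine le_trans ?_ hc
        rw [le_div_iff₀ hl2]
        exact (mul_le_mul_of_nonneg_left hlp (by positivity)).trans h1
      have h3 : Real.log ((n.factorization p : ℝ) + 1) ≤ Real.log (1 + c) :=
        Real.log_le_log (by positivity) (by linarith)
      have h4 : 0 ≤ Real.log p := hl2.le.trans hlp
      have : 0 ≤ Real.log 2 / Real.log z * (n.factorization p * Real.log p) := by positivity
      linarith
    · push Not at h
      have h1 : Real.log ((n.factorization p : ℝ) + 1) ≤ n.factorization p * Real.log 2 := by
        rw [← Real.log_pow]
        refine Real.log_le_log (by positivity) ?_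
        exact_mod_cast Nat.lt_two_pow_self
      have h2 : 1 ≤ Real.log p / Real.log z := by
        rw [one_le_div hlz]
        exact Real.log_le_log (by linarith) h.le
      calc _ ≤ (n.factorization p * Real.log 2) * 1 := by simpa using h1
        _ ≤ (n.factorization p * Real.log 2) * (Real.log p / Real.log z) := by gcongr
        _ = _ := by ring
  refine (Finset.sum_le_sum key).trans ?_
  rw [Finset.sum_add_distrib, ← Finset.mul_sum, ← hsum, ← Finset.sum_filter, Finset.sum_const,
    nsmul_eq_mul]
  have hcard : ((n.primeFactors.filter (fun p : ℕ => (p : ℝ) ≤ z)).card : ℝ) ≤ z := by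
    have hsub : n.primeFactors.filter (fun p : ℕ => (p : ℝ) ≤ z) ⊆ Finset.Icc 1 ⌊z⌋₊ := by
      intro p hp
      rw [Finset.mem_filter] at hp
      exact Finset.mem_Icc.2 ⟨(Nat.prime_of_mem_primeFactors hp.1).one_le, Nat.le_floor hp.2⟩
    have := Finset.card_le_card hsub
    rw [Nat.card_Icc, Nat.add_sub_cancel] at this
    exact (Nat.cast_le.2 this).trans (Nat.floor_le (by linarith))
  have := mul_le_mul_of_nonneg_right hcard hlc
  have e : Real.log 2 / Real.log z * Real.log n = Real.log 2 * (Real.log n / Real.log z) := by ring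
  linarith

theorem exists_card_divisors_le_expLogDivLogLog_pow (B : ℕ) :
    ∃ A : ℕ, ∀ h : ℕ, 3 ≤ h → ∀ n : ℕ, n ≠ 0 → n ≤ h ^ B →
      (n.divisors.card : ℝ) ≤ expLogDivLogLog h ^ A := by
  refine ⟨16 + 6 * B, fun h hh n hn hnB => ?_⟩
  set L := Real.log h with hL
  have hL1 : 1 < L := one_lt_log_natCast hh
  have hLL : 0 < Real.log L := Real.log_pos hL1
  have hlogn : Real.log n ≤ B * L := by
    rw [hL, ← Real.log_pow]
    exact Real.log_le_log (by positivity) (by exact_mod_cast hnB)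
  have hl2 : 1 / 2 < Real.log 2 := by linarith [Real.log_two_gt_d9]
  have hl2' : Real.log 2 < 1 := by linarith [Real.log_two_lt_d9]
  have hz : 1 < √L := by rw [Real.lt_sqrt (by norm_num)]; simpa using hL1
  have hc : Real.log n / Real.log 2 ≤ 2 * B * L := by
    rw [div_le_iff₀ (by linarith)]
    have : (0 : ℝ) ≤ B * L := by positivity
    nlinarith
  have h1 := log_card_divisors_le hn hz hc
  have hd : (0 : ℝ) < n.divisors.card := by
    exact_mod_cast Finset.card_pos.2 ⟨1, by simpa using hn⟩
  have hE : expLogDivLogLog h ^ (16 + 6 * B) =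
      Real.exp ((16 + 6 * B : ℕ) * (L / Real.log L)) := by
    rw [expLogDivLogLog, ← Real.exp_nat_mul]
  rw [hE, ← Real.log_le_iff_le_exp hd, ← mul_div_assoc, le_div_iff₀ hLL]
  refine (mul_le_mul_of_nonneg_right h1 hLL.le).trans ?_
  have hs0 : 0 < √L := by linarith
  have hss : √L * √L = L := Real.mul_self_sqrt (by linarith)
  have hqq : √(√L) * √(√L) = √L := Real.mul_self_sqrt hs0.le
  have hq0 : 0 < √(√L) := Real.sqrt_pos.2 hs0
  have e1 : Real.log √L = Real.log L / 2 := Real.log_sqrt (by linarith)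
  have e2 : Real.log √(√L) = Real.log L / 4 := by
    rw [Real.log_sqrt hs0.le, e1]; ring
  have b1 : Real.log L ≤ 2 * √L := by
    have := Real.log_le_sub_one_of_pos hs0
    linarith
  have b2 : Real.log L ≤ 4 * √(√L) := by
    have := Real.log_le_sub_one_of_pos hq0
    linarith
  have b3 : Real.log L * Real.log L ≤ 16 * √L := by nlinarith
  have b4 : Real.log (1 + 2 * B * L) ≤ 2 * B + Real.log L := by
    have h2 : Real.log (1 + 2 * B * L) ≤ Real.log ((1 + 2 * B) * L) :=
      Real.log_le_log (by positivity) (by nlinarith)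
    rw [Real.log_mul (by positivity) (by positivity)] at h2
    have := Real.log_le_sub_one_of_pos (show (0 : ℝ) < 1 + 2 * B by positivity)
    linarith
  have b5 : √L * Real.log (1 + 2 * B * L) * Real.log L ≤ (16 + 4 * B) * L := by
    calc _ ≤ √L * (2 * B + Real.log L) * Real.log L := by gcongr
      _ = 2 * B * √L * Real.log L + √L * (Real.log L * Real.log L) := by ring
      _ ≤ 2 * B * √L * (2 * √L) + √L * (16 * √L) := by gcongr
      _ = (16 + 4 * B) * (√L * √L) := by ring
      _ = _ := by rw [hss]
  have b6 : Real.log 2 * (Real.log n / Real.log √L) * Real.log L ≤ 2 * B * L := by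
    rw [e1]
    have : Real.log 2 * (Real.log n / (Real.log L / 2)) * Real.log L
        = Real.log 2 * (2 * Real.log n) := by field_simp
    rw [this]
    have hn1 : 0 ≤ Real.log n := Real.log_natCast_nonneg n
    nlinarith
  push_cast
  linarith

open Polynomial

lemma exists_natDegree_two_le_forall_dvd {σ : ℂ} (hσ : ∀ q : ℚ, (q : ℂ) ≠ σ)
    (halg : IsAlgebraic ℚ σ) :
    ∃ f : ℤ[X], 2 ≤ f.natDegree ∧ ∀ P : ℤ[X], aeval σ P = 0 → f ∣ P := by
  obtain ⟨b, hb, hg⟩ := IsLocalization.integerNormalization_spec (nonZeroDivisors ℤ) (minpoly ℚ σ)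
  set g := IsLocalization.integerNormalization (nonZeroDivisors ℤ) (minpoly ℚ σ)
  have hb0 : b ≠ 0 := nonZeroDivisors.ne_zero hb
  have hb0' : (b : ℚ) ≠ 0 := by exact_mod_cast hb0
  have hg' : g.map (Int.castRingHom ℚ) = C (b : ℚ) * minpoly ℚ σ := by
    rw [← algebraMap_int_eq, hg, ← smul_eq_C_mul, Int.cast_smul_eq_zsmul]
  refine ⟨g.primPart, ?_, fun P hP => ?_⟩
  · rw [natDegree_primPart, ← natDegree_map_eq_of_injective
      (RingHom.injective_int (Int.castRingHom ℚ)) g, hg', natDegree_C_mul hb0',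
      minpoly.two_le_natDegree_iff halg.isIntegral]
    rintro ⟨q, hq⟩
    exact hσ q (by simpa using hq)
  · rw [IsPrimitive.Int.dvd_iff_map_cast_dvd_map_cast _ _ g.isPrimitive_primPart]
    have h1 : g.primPart.map (Int.castRingHom ℚ) ∣ C (b : ℚ) * minpoly ℚ σ :=
      hg' ▸ Polynomial.map_dvd _ g.primPart_dvd
    have h2 : C (b : ℚ) * minpoly ℚ σ ∣ minpoly ℚ σ :=
      ⟨C (b : ℚ)⁻¹, by rw [mul_right_comm, ← C_mul, mul_inv_cancel₀ hb0', C_1, one_mul]⟩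
    refine h1.trans (h2.trans (minpoly.dvd _ _ ?_))
    rw [← algebraMap_int_eq, aeval_map_algebraMap, hP]

/-- The monic polynomial `∏ i, (X + x i)`. -/
noncomputable def shiftPoly {k : ℕ} (x : Fin k → ℤ) : ℤ[X] := ∏ i, (X + C (x i))

lemma natDegree_shiftPoly {k : ℕ} (x : Fin k → ℤ) : (shiftPoly x).natDegree = k := by
  rw [shiftPoly, natDegree_prod_of_monic _ _ fun i _ => monic_X_add_C _]
  simp only [natDegree_X_add_C, Finset.sum_const, Finset.card_univ, Fintype.card_fin, smul_eq_mul,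
    mul_one]

lemma eval_shiftPoly {k : ℕ} (x : Fin k → ℤ) (t : ℤ) :
    (shiftPoly x).eval t = ∏ i, (t + x i) := by
  simp [shiftPoly, eval_prod]

lemma aeval_shiftPoly {k : ℕ} (x : Fin k → ℤ) (σ : ℂ) :
    aeval σ (shiftPoly x) = ∏ i, ((x i : ℂ) + σ) := by
  simp [shiftPoly, add_comm, map_prod]

lemma norm_coeff_prod_C_mul_X_add_C_le {ι : Type*} (s : Finset ι) (a : ℂ) (x : ι → ℂ) (M : ℝ)
    (hM : ∀ i ∈ s, ‖a‖ + ‖x i‖ ≤ M) (n : ℕ) :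
    ‖(∏ i ∈ s, (C a * X + C (x i))).coeff n‖ ≤ M ^ s.card := by
  classical
  induction s using Finset.induction_on generalizing n with
  | empty => simp only [Finset.prod_empty, coeff_one]; split_ifs <;> simp
  | insert i s hi ih =>
    have hs := fun n => ih (fun j hj => hM j (Finset.mem_insert_of_mem hj)) n
    have hMi := hM i (Finset.mem_insert_self _ _)
    have hM0 : 0 ≤ M ^ s.card := (norm_nonneg _).trans (hs 0)
    rw [Finset.prod_insert hi, Finset.card_insert_of_notMem hi, pow_succ', add_mul, coeff_add,
      mul_assoc, coeff_C_mul, coeff_C_mul]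
    have h1 : ‖(X * ∏ i ∈ s, (C a * X + C (x i))).coeff n‖ ≤ M ^ s.card := by
      cases n with
      | zero => simpa using hM0
      | succ n => rw [coeff_X_mul]; exact hs n
    calc _ ≤ ‖a‖ * M ^ s.card + ‖x i‖ * M ^ s.card := by
          refine (norm_add_le _ _).trans ?_
          rw [norm_mul, norm_mul]
          gcongr
          exact hs n
      _ = (‖a‖ + ‖x i‖) * M ^ s.card := by ring
      _ ≤ _ := by gcongr

lemma mahlerMeasure_le_of_norm_coeff_le {p : ℂ[X]} {k : ℕ} {M : ℝ} (hM : 0 ≤ M)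
    (hk : p.natDegree ≤ k) (hp : ∀ n, ‖p.coeff n‖ ≤ M) : p.mahlerMeasure ≤ (k + 1) * M := by
  refine p.mahlerMeasure_le_sum_norm_coeff.trans ?_
  rw [sum_over_range _ (by simp)]
  refine (Finset.sum_le_card_nsmul _ _ M fun n _ => hp n).trans ?_
  rw [Finset.card_range, nsmul_eq_mul]
  push_cast
  gcongr

lemma norm_eval_le_mahlerMeasure (p : ℂ[X]) {k : ℕ} (hk : p.natDegree ≤ k) {z : ℂ}
    (hz : ‖z‖ ≤ 1) : ‖p.eval z‖ ≤ (k + 1) * 2 ^ k * p.mahlerMeasure := by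
  rw [eval_eq_sum_range' (Nat.lt_succ_of_le hk)]
  refine (norm_sum_le _ _).trans ?_
  refine (Finset.sum_le_card_nsmul _ _ (2 ^ k * p.mahlerMeasure) fun n _ => ?_).trans_eq ?_
  · rw [norm_mul, norm_pow]
    calc _ ≤ ‖p.coeff n‖ * 1 := by gcongr; exact pow_le_one₀ (norm_nonneg z) hz
      _ ≤ (p.natDegree.choose n) * p.mahlerMeasure := by
        rw [mul_one]; exact norm_coeff_le_choose_mul_mahlerMeasure n p
      _ ≤ _ := by
        gcongr
        · exact p.mahlerMeasure_nonneg
        · calc ((p.natDegree.choose n : ℕ) : ℝ) ≤ 2 ^ p.natDegree := by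
                exact_mod_cast Nat.choose_le_two_pow _ _
            _ ≤ 2 ^ k := pow_le_pow_right₀ (by norm_num) hk
  · simp [mul_assoc]

/-- If `f` has degree at least two, a cofactor of `f` in the difference of two shift polynomials
saves a factor `h ^ 2` over the trivial bound. -/
lemma sq_mul_abs_eval_cofactor_le {k h : ℕ} (hh : 1 ≤ h) {x y : Fin k → ℤ}
    (hx : ∀ i, 1 ≤ x i ∧ x i ≤ h) (hy : ∀ i, 1 ≤ y i ∧ y i ≤ h) {f q : ℤ[X]}
    (hf : 2 ≤ f.natDegree) (hfq : shiftPoly x - shiftPoly y = f * q) {t : ℤ}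
    (ht : |t| ≤ h) :
    (h : ℝ) ^ 2 * |(q.eval t : ℤ)| ≤ (k + 1) ^ 2 * 2 ^ (2 * k + 1) * (h : ℝ) ^ k := by
  have hh0 : (h : ℂ) ≠ 0 := by exact_mod_cast (by omega : h ≠ 0)
  have hhR : (1 : ℝ) ≤ h := by exact_mod_cast hh
  let S : ℤ[X] → ℂ[X] := fun p => (p.map (Int.castRingHom ℂ)).comp (C (h : ℂ) * X)
  have hdegS : ∀ p, (S p).natDegree = p.natDegree := by
    intro p
    simp only [S]
    rw [natDegree_comp, natDegree_C_mul_X _ hh0, mul_one,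
      natDegree_map_eq_of_injective (RingHom.injective_int (Int.castRingHom ℂ))]
  have hSx : ∀ x : Fin k → ℤ, S (shiftPoly x) = ∏ i, (C (h : ℂ) * X + C (x i : ℂ)) := by
    intro x
    simp [S, shiftPoly, Polynomial.map_prod, Polynomial.prod_comp]
  have hcoeff : ∀ x : Fin k → ℤ, (∀ i, 1 ≤ x i ∧ x i ≤ h) → ∀ n,
      ‖(S (shiftPoly x)).coeff n‖ ≤ (2 * h : ℝ) ^ k := by
    intro x hx n
    rw [hSx]
    refine (norm_coeff_prod_C_mul_X_add_C_le _ _ _ (2 * h) (fun i _ => ?_) n).trans_eq (by simp)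
    have h1 : ‖((x i : ℤ) : ℂ)‖ ≤ h := by
      rw [Complex.norm_intCast, abs_le]
      have := hx i
      exact ⟨by exact_mod_cast (by omega : -(h : ℤ) ≤ x i), by exact_mod_cast this.2⟩
    rw [Complex.norm_natCast]
    linarith
  have hmul : S f * S q = S (shiftPoly x) - S (shiftPoly y) := by
    simp only [S]
    rw [← mul_comp, ← Polynomial.map_mul, ← hfq, Polynomial.map_sub, sub_comp]
  have hR : (S f * S q).mahlerMeasure ≤ (k + 1) * (2 * (2 * h) ^ k) := by
    refine mahlerMeasure_le_of_norm_coeff_le (by positivity) ?_ fun n => ?_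
    · rw [hmul]
      refine (natDegree_sub_le _ _).trans ?_
      rw [hdegS, hdegS, natDegree_shiftPoly, natDegree_shiftPoly, max_self]
    · rw [hmul, coeff_sub]
      refine (norm_sub_le _ _).trans ?_
      linarith [hcoeff x hx n, hcoeff y hy n]
  have hlc : (h : ℝ) ^ 2 ≤ (S f).mahlerMeasure := by
    refine le_trans ?_ (leadingCoeff_le_mahlerMeasure (S f))
    simp only [S]
    have hf0 : f ≠ 0 := by rintro rfl; simp at hf
    have h1 : (1 : ℝ) ≤ |(f.leadingCoeff : ℝ)| := by
      exact_mod_cast Int.one_le_abs (leadingCoeff_ne_zero.2 hf0)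
    rw [leadingCoeff_comp (by rw [natDegree_C_mul_X _ hh0]; norm_num),
      leadingCoeff_map_of_injective (RingHom.injective_int (Int.castRingHom ℂ)),
      natDegree_map_eq_of_injective (RingHom.injective_int (Int.castRingHom ℂ)),
      leadingCoeff_C_mul_X, norm_mul, norm_pow, Complex.norm_natCast]
    simp only [eq_intCast, Complex.norm_intCast]
    calc (h : ℝ) ^ 2 ≤ 1 * (h : ℝ) ^ f.natDegree := by
          rw [one_mul]; exact pow_le_pow_right₀ hhR hf
      _ ≤ _ := by gcongr
  by_cases hq : q = 0
  · simp only [hq, eval_zero, abs_zero, Int.cast_zero, mul_zero]; positivity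
  have hdq : q.natDegree ≤ k := by
    have hf0 : f ≠ 0 := by rintro rfl; simp at hf
    have h1 : (f * q).natDegree ≤ k := by
      rw [← hfq]
      refine (natDegree_sub_le _ _).trans ?_
      rw [natDegree_shiftPoly, natDegree_shiftPoly, max_self]
    rw [natDegree_mul hf0 hq] at h1
    omega
  have hev : ‖(S q).eval ((t : ℂ) / h)‖ = |((q.eval t : ℤ) : ℝ)| := by
    simp only [S]
    rw [eval_comp, eval_mul, eval_C, eval_X, mul_div_cancel₀ _ hh0]
    rw [← Complex.norm_intCast, eval_intCast_map]
    simp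
  have hz : ‖(t : ℂ) / h‖ ≤ 1 := by
    rw [norm_div, Complex.norm_natCast, Complex.norm_intCast, div_le_one (by linarith)]
    exact_mod_cast ht
  have h2 := norm_eval_le_mahlerMeasure (S q) ((hdegS q).trans_le hdq) hz
  rw [hev] at h2
  rw [mahlerMeasure_mul] at hR
  rw [Int.cast_abs]
  calc _ ≤ (S f).mahlerMeasure * ((k + 1) * 2 ^ k * (S q).mahlerMeasure) := by
        gcongr
        exact mahlerMeasure_nonneg _
    _ = (k + 1) * 2 ^ k * ((S f).mahlerMeasure * (S q).mahlerMeasure) := by ring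
    _ ≤ (k + 1) * 2 ^ k * ((k + 1) * (2 * (2 * h) ^ k)) := by gcongr
    _ = _ := by ring

/-- If `f` divides `P - Q`, then `∏ f(-x i) = ∏ f(-y i)`: both are the resultant of `f` with the
shift polynomial. -/
lemma prod_eval_neg_eq_of_dvd {k : ℕ} {x y : Fin k → ℤ} {f : ℤ[X]}
    (hf : f ∣ shiftPoly x - shiftPoly y) :
    ∏ i, f.eval (-x i) = ∏ i, f.eval (-y i) := by
  set F := f.map (Int.castRingHom ℂ) with hF
  have hsplit : F.Splits := IsAlgClosed.splits F
  have key : ∀ x : Fin k → ℤ, ((∏ i, f.eval (-x i) : ℤ) : ℂ) =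
      F.leadingCoeff ^ k * (F.roots.map fun r => (-1) ^ k * aeval r (shiftPoly x)).prod := by
    intro x
    have h1 : ∀ i, ((f.eval (-x i) : ℤ) : ℂ) =
        F.leadingCoeff * (F.roots.map fun r => (-(x i : ℂ) - r)).prod := by
      intro i
      rw [← hsplit.eval_eq_prod_roots, hF]
      have := eval_intCast_map (Int.castRingHom ℂ) f (-x i)
      simpa using this.symm
    rw [Int.cast_prod, Finset.prod_congr rfl fun i _ => h1 i, Finset.prod_mul_distrib,
      Finset.prod_const, Finset.card_univ, Fintype.card_fin, ← Multiset.prod_map_prod]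
    congr 3
    funext r
    rw [aeval_shiftPoly, show (-1 : ℂ) ^ k = ∏ _i : Fin k, (-1 : ℂ) by simp,
      ← Finset.prod_mul_distrib]
    exact Finset.prod_congr rfl fun i _ => by ring
  have : ((∏ i, f.eval (-x i) : ℤ) : ℂ) = ((∏ i, f.eval (-y i) : ℤ) : ℂ) := by
    rw [key, key]
    congr 2
    refine Multiset.map_congr rfl fun r hr => ?_
    congr 1
    rw [← sub_eq_zero, ← map_sub]
    obtain ⟨q, hq⟩ := hf
    have h0 : aeval r f = 0 := by
      have := (mem_roots'.1 hr).2
      rwa [hF, IsRoot.def, eval_map, ← algebraMap_int_eq, ← aeval_def] at this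
    rw [hq, map_mul, h0, zero_mul]
  exact_mod_cast this

lemma Int.card_divisors (z : ℤ) : z.divisors.card = 2 * z.natAbs.divisors.card := by
  rw [Int.divisors, Finset.card_disjUnion, Finset.card_map, Finset.card_map, two_mul]

/-- The integer points of the cube `[1, h] ^ k`. -/
noncomputable def intBox (k h : ℕ) : Finset (Fin k → ℤ) := Fintype.piFinset fun _ => Finset.Icc 1 (h : ℤ)

lemma mem_intBox {k h : ℕ} {x : Fin k → ℤ} : x ∈ intBox k h ↔ ∀ i, 1 ≤ x i ∧ x i ≤ h := by
  simp [intBox]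

lemma card_intBox (k h : ℕ) : (intBox k h).card = h ^ k := by
  simp [intBox]

open Classical in
/-- The solutions of the shifted product equation whose shift polynomials differ. -/
noncomputable def nondiagonalSolutions (k h : ℕ) (σ : ℂ) : Finset ((Fin k → ℤ) × (Fin k → ℤ)) :=
  (intBox k h ×ˢ intBox k h).filter fun p =>
    shiftPoly p.1 ≠ shiftPoly p.2 ∧ aeval σ (shiftPoly p.1) = aeval σ (shiftPoly p.2)

/-- The nondiagonal solutions without common entries on the two sides. -/
noncomputable def disjointSolutions (k h : ℕ) (σ : ℂ) : Finset ((Fin k → ℤ) × (Fin k → ℤ)) :=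
  (nondiagonalSolutions k h σ).filter fun p => ∀ i j, p.1 i ≠ p.2 j

lemma mem_nondiagonalSolutions {k h : ℕ} {σ : ℂ} {p : (Fin k → ℤ) × (Fin k → ℤ)} :
    p ∈ nondiagonalSolutions k h σ ↔ (p.1 ∈ intBox k h ∧ p.2 ∈ intBox k h) ∧
      shiftPoly p.1 ≠ shiftPoly p.2 ∧ aeval σ (shiftPoly p.1) = aeval σ (shiftPoly p.2) := by
  simp [nondiagonalSolutions]

lemma mem_disjointSolutions {k h : ℕ} {σ : ℂ} {p : (Fin k → ℤ) × (Fin k → ℤ)} :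
    p ∈ disjointSolutions k h σ ↔ p ∈ nondiagonalSolutions k h σ ∧ ∀ i j, p.1 i ≠ p.2 j := by
  simp [disjointSolutions]

lemma card_filter_eval_neg_dvd_le {f : ℤ[X]} {k D : ℕ} (hf : 0 < f.natDegree)
    (hk : f.natDegree ≤ k) {M : ℤ} (hM : M ≠ 0) (hD : M.natAbs.divisors.card ≤ D)
    (s : Finset ℤ) : (s.filter fun y => f.eval (-y) ∣ M).card ≤ k * (2 * D) := by
  refine (Finset.card_le_mul_card_image (f := fun y => f.eval (-y)) _ k fun v _ => ?_).trans ?_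
  · have hne : f - C v ≠ 0 := by
      intro h0
      rw [← natDegree_sub_C (a := v), h0] at hf
      simp at hf
    calc _ ≤ (f - C v).roots.toFinset.card := by
          refine Finset.card_le_card_of_injOn (fun y => -y) (fun y hy => ?_)
            (neg_injective.injOn)
          have : f.eval (-y) = v := (Finset.mem_filter.1 hy).2
          simp only [Finset.mem_coe, Multiset.mem_toFinset]
          rw [mem_roots hne]
          simp [this]
      _ ≤ (f - C v).roots.card := Multiset.toFinset_card_le _
      _ ≤ (f - C v).natDegree := card_roots' _
      _ ≤ k := by rwa [natDegree_sub_C]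
  · refine Nat.mul_le_mul_left _ ((Finset.card_le_card (t := M.divisors) ?_).trans ?_)
    · intro v hv
      obtain ⟨y, hy, rfl⟩ := Finset.mem_image.1 hv
      exact Int.mem_divisors.2 ⟨(Finset.mem_filter.1 hy).2, hM⟩
    · rw [Int.card_divisors]; omega

lemma eval_neg_shiftPoly_sub {k : ℕ} (x y : Fin k → ℤ) (i : Fin k) :
    (shiftPoly x - shiftPoly y).eval (-y i) = ∏ j, (x j - y i) := by
  rw [eval_sub, eval_shiftPoly, eval_shiftPoly,
    Finset.prod_eq_zero (f := fun j => -y i + y j) (Finset.mem_univ i) (by ring), sub_zero]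
  exact Finset.prod_congr rfl fun j _ => by ring

lemma natAbs_prod_sub_le {k h : ℕ} {x : Fin k → ℤ} (hx : x ∈ intBox k h) {c : ℤ} (hc : 1 ≤ c)
    (hc' : c ≤ h) : (∏ j, (x j - c)).natAbs ≤ h ^ k := by
  rw [← Int.natAbsHom_apply, map_prod]
  refine (Finset.prod_le_pow_card _ _ h fun j _ => ?_).trans_eq (by simp)
  have := mem_intBox.1 hx j
  rw [Int.natAbsHom_apply]
  omega

lemma card_disjointSolutions_le_of_forall {k h D M : ℕ} {σ : ℂ} {f : ℤ[X]} (hh : 1 ≤ h)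
    (hf : 2 ≤ f.natDegree) (hfσ : ∀ P : ℤ[X], aeval σ P = 0 → f ∣ P)
    (hD : ∀ n : ℕ, n ≠ 0 → n ≤ h ^ (k * k) → n.divisors.card ≤ D)
    (hM : ∀ p ∈ disjointSolutions k h σ, ∀ q, shiftPoly p.1 - shiftPoly p.2 = f * q →
      ∀ t : ℤ, |t| ≤ h → |q.eval t| ≤ M) :
    (disjointSolutions k h σ).card ≤
      (k * (2 * D)) ^ k * ((h * (2 * M + 1)) * (2 * D) ^ k) := by
  classical
  rcases (disjointSolutions k h σ).eq_empty_or_nonempty with he | ⟨p₀, hp₀⟩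
  · simp [he]
  have hdvd : ∀ p ∈ disjointSolutions k h σ, f ∣ shiftPoly p.1 - shiftPoly p.2 := by
    intro p hp
    have := (mem_nondiagonalSolutions.1 (mem_disjointSolutions.1 hp).1).2.2
    exact hfσ _ (by rw [map_sub, this, sub_self])
  have hdeg : f.natDegree ≤ k := by
    have hne := (mem_nondiagonalSolutions.1 (mem_disjointSolutions.1 hp₀).1).2.1
    refine (natDegree_le_of_dvd (hdvd _ hp₀) (sub_ne_zero.2 hne)).trans ?_
    refine (natDegree_sub_le _ _).trans ?_
    rw [natDegree_shiftPoly, natDegree_shiftPoly, max_self]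
  have hkk : h ^ k ≤ h ^ (k * k) := Nat.pow_le_pow_right hh (Nat.le_mul_self k)
  have hprod : ∀ p ∈ disjointSolutions k h σ,
      (∏ i, f.eval (-p.1 i)) ≠ 0 ∧ (∏ i, f.eval (-p.1 i)).natAbs ≤ h ^ (k * k) := by
    intro p hp
    obtain ⟨hp1, hdisj⟩ := mem_disjointSolutions.1 hp
    obtain ⟨⟨hx, hy⟩, -, -⟩ := mem_nondiagonalSolutions.1 hp1
    have hi : ∀ i, f.eval (-p.1 i) ≠ 0 ∧ (f.eval (-p.1 i)).natAbs ≤ h ^ k := by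
      intro i
      have h1 : f.eval (-p.1 i) ∣ ∏ j, (p.2 j - p.1 i) := by
        rw [← eval_neg_shiftPoly_sub]
        exact eval_dvd (by rw [← neg_sub]; exact (dvd_neg.2 (hdvd p hp)))
      have h2 : ∏ j, (p.2 j - p.1 i) ≠ 0 :=
        Finset.prod_ne_zero_iff.2 fun j _ => sub_ne_zero.2 (hdisj i j).symm
      have hxi := mem_intBox.1 hx i
      exact ⟨ne_zero_of_dvd_ne_zero h2 h1,
        (Nat.le_of_dvd (Int.natAbs_pos.2 h2) (Int.natAbs_dvd_natAbs.2 h1)).trans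
          (natAbs_prod_sub_le hy hxi.1 hxi.2)⟩
    refine ⟨Finset.prod_ne_zero_iff.2 fun i _ => (hi i).1, ?_⟩
    rw [← Int.natAbsHom_apply, map_prod]
    refine (Finset.prod_le_pow_card _ _ (h ^ k) fun i _ => (hi i).2).trans_eq ?_
    rw [Finset.card_univ, Fintype.card_fin, ← pow_mul]
  refine (Finset.card_le_mul_card_image (f := Prod.fst) _ ((k * (2 * D)) ^ k) ?_).trans
    (Nat.mul_le_mul_left _ ?_)
  · intro x hx
    obtain ⟨p, hp, rfl⟩ := Finset.mem_image.1 hx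
    obtain ⟨hne, hle⟩ := hprod p hp
    set Y := (Finset.Icc (1 : ℤ) h).filter fun y => f.eval (-y) ∣ ∏ i, f.eval (-p.1 i)
    have hY : Y.card ≤ k * (2 * D) := card_filter_eval_neg_dvd_le (by omega) hdeg hne
      (hD _ (Int.natAbs_ne_zero.2 hne) hle) _
    calc _ ≤ (Fintype.piFinset fun _ : Fin k => Y).card := by
          refine Finset.card_le_card_of_injOn Prod.snd (fun r hr => ?_) ?_
          · obtain ⟨hr, hr1⟩ := Finset.mem_filter.1 hr
            obtain ⟨⟨-, hy⟩, -, -⟩ := mem_nondiagonalSolutions.1 (mem_disjointSolutions.1 hr).1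
            simp only [Finset.mem_coe, Fintype.mem_piFinset]
            intro i
            refine Finset.mem_filter.2 ⟨Finset.mem_Icc.2 (mem_intBox.1 hy i), ?_⟩
            rw [← hr1, prod_eval_neg_eq_of_dvd (hdvd r hr)]
            exact Finset.dvd_prod_of_mem _ (Finset.mem_univ i)
          · intro r hr s hs hrs
            exact Prod.ext ((Finset.mem_filter.1 hr).2.trans (Finset.mem_filter.1 hs).2.symm) hrs
      _ = Y.card ^ k := by simp
      _ ≤ _ := Nat.pow_le_pow_left hY k
  · let U : ℤ × ℤ → Finset (Fin k → ℤ) := fun a =>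
      if (f.eval (-a.1) * a.2) ≠ 0 ∧ (f.eval (-a.1) * a.2).natAbs ≤ h ^ (k * k) then
        Fintype.piFinset fun _ => (f.eval (-a.1) * a.2).divisors.image (· + a.1) else ∅
    have hU : ∀ a, (U a).card ≤ (2 * D) ^ k := by
      intro a
      simp only [U]
      split_ifs with ha
      · rw [Fintype.card_piFinset_const]
        refine Nat.pow_le_pow_left (Finset.card_image_le.trans ?_) k
        rw [Int.card_divisors]
        have := hD _ (Int.natAbs_ne_zero.2 ha.1) ha.2
        omega
      · simp
    have hsub : (disjointSolutions k h σ).image Prod.fst ⊆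
        (Finset.Icc (1 : ℤ) h ×ˢ Finset.Icc (-(M : ℤ)) M).biUnion U := by
      intro x hx
      obtain ⟨p, hp, rfl⟩ := Finset.mem_image.1 hx
      obtain ⟨hp1, hdisj⟩ := mem_disjointSolutions.1 hp
      obtain ⟨⟨hx, hy⟩, -, -⟩ := mem_nondiagonalSolutions.1 hp1
      obtain ⟨q, hq⟩ := hdvd p hp
      have i₀ : Fin k := ⟨0, by omega⟩
      have hyi := mem_intBox.1 hy i₀
      have hN : f.eval (-p.2 i₀) * q.eval (-p.2 i₀) = ∏ j, (p.1 j - p.2 i₀) := by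
        rw [← eval_mul, ← hq, eval_neg_shiftPoly_sub]
      have hN0 : ∏ j, (p.1 j - p.2 i₀) ≠ 0 :=
        Finset.prod_ne_zero_iff.2 fun j _ => sub_ne_zero.2 (hdisj j i₀)
      have hqM := hM p hp q hq (-p.2 i₀) (by rw [abs_neg, abs_of_pos (by omega)]; exact hyi.2)
      refine Finset.mem_biUnion.2 ⟨(p.2 i₀, q.eval (-p.2 i₀)), ?_, ?_⟩
      · exact Finset.mem_product.2 ⟨Finset.mem_Icc.2 hyi, Finset.mem_Icc.2 (abs_le.1 hqM)⟩
      · simp only [U, hN]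
        rw [if_pos ⟨hN0, (natAbs_prod_sub_le hx hyi.1 hyi.2).trans hkk⟩, Fintype.mem_piFinset]
        intro i
        exact Finset.mem_image.2 ⟨p.1 i - p.2 i₀, Int.mem_divisors.2
          ⟨Finset.dvd_prod_of_mem (fun j => p.1 j - p.2 i₀) (Finset.mem_univ i), hN0⟩, by ring⟩
    refine (Finset.card_le_card hsub).trans ?_
    refine (Finset.card_biUnion_le_card_mul _ _ _ fun a _ => hU a).trans_eq ?_
    rw [Finset.card_product, Int.card_Icc, Int.card_Icc]
    congr 2 <;> omega

lemma isAlgebraic_of_mem_nondiagonalSolutions {k h : ℕ} {σ : ℂ}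
    {p : (Fin k → ℤ) × (Fin k → ℤ)} (hp : p ∈ nondiagonalSolutions k h σ) : IsAlgebraic ℚ σ := by
  obtain ⟨-, hne, heq⟩ := mem_nondiagonalSolutions.1 hp
  have : IsAlgebraic ℤ σ :=
    ⟨shiftPoly p.1 - shiftPoly p.2, sub_ne_zero.2 hne, by rw [map_sub, heq, sub_self]⟩
  exact (IsFractionRing.isAlgebraic_iff ℤ ℚ ℂ).1 this

lemma exists_card_disjointSolutions_mul_le (k : ℕ) :
    ∃ A : ℕ, ∀ h : ℕ, 3 ≤ h → ∀ σ : ℂ, (∀ q : ℚ, (q : ℂ) ≠ σ) →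
      ((disjointSolutions k h σ).card : ℝ) * h ≤ (h : ℝ) ^ k * expLogDivLogLog h ^ A := by
  obtain ⟨A₀, hA₀⟩ := exists_card_divisors_le_expLogDivLogLog_pow (k * k)
  set c : ℕ := (k + 1) ^ 2 * 2 ^ (2 * k + 1) with hc
  set c' : ℕ := (k * 2) ^ k * 2 ^ k * (2 * c + 1) with hc'
  refine ⟨c' + 2 * (A₀ * k), fun h hh σ hσ => ?_⟩
  have hE := two_le_expLogDivLogLog hh
  set E := expLogDivLogLog h
  have hE0 : 0 < E := by linarith
  rcases (disjointSolutions k h σ).eq_empty_or_nonempty with he | ⟨p₀, hp₀⟩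
  · rw [he]; simp only [Finset.card_empty, Nat.cast_zero, zero_mul]; positivity
  have hp₀' := (mem_disjointSolutions.1 hp₀).1
  obtain ⟨f, hf, hfσ⟩ := exists_natDegree_two_le_forall_dvd hσ
    (isAlgebraic_of_mem_nondiagonalSolutions hp₀')
  have hk : 2 ≤ k := by
    obtain ⟨-, hne, heq⟩ := mem_nondiagonalSolutions.1 hp₀'
    have := natDegree_le_of_dvd (hfσ _ (by rw [map_sub, heq, sub_self])) (sub_ne_zero.2 hne)
    have h2 := natDegree_sub_le (shiftPoly p₀.1) (shiftPoly p₀.2)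
    rw [natDegree_shiftPoly, natDegree_shiftPoly, max_self] at h2
    omega
  have hh2 : 0 < h ^ 2 := by positivity
  have key := card_disjointSolutions_le_of_forall (k := k) (h := h) (D := ⌊E ^ A₀⌋₊)
    (M := c * h ^ k / h ^ 2) (by omega) hf hfσ
    (fun n hn hnh => Nat.le_floor (hA₀ h hh n hn hnh)) (by
      intro p hp q hq t ht
      obtain ⟨⟨hx, hy⟩, -, -⟩ := mem_nondiagonalSolutions.1 (mem_disjointSolutions.1 hp).1
      have h1 := sq_mul_abs_eval_cofactor_le (by omega) (mem_intBox.1 hx) (mem_intBox.1 hy)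
        hf hq ht
      have h2 : h ^ 2 * (q.eval t).natAbs ≤ c * h ^ k := by
        have : ((h ^ 2 * (q.eval t).natAbs : ℕ) : ℝ) ≤ ((c * h ^ k : ℕ) : ℝ) := by
          rw [hc]
          push_cast [Nat.cast_natAbs]
          push_cast at h1
          exact h1
        exact_mod_cast this
      rw [← Int.natCast_natAbs]
      exact_mod_cast (Nat.le_div_iff_mul_le hh2).2 (by rwa [mul_comm]))
  set D := ⌊E ^ A₀⌋₊
  set M := c * h ^ k / h ^ 2
  have hDE : (D : ℝ) ≤ E ^ A₀ := Nat.floor_le (by positivity)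
  have hMh : h ^ 2 * (2 * M + 1) ≤ (2 * c + 1) * h ^ k := by
    have h1 : h ^ 2 * M ≤ c * h ^ k := Nat.mul_div_le _ _
    have h2 : h ^ 2 ≤ h ^ k := Nat.pow_le_pow_right (by omega) hk
    nlinarith
  have hcE : (c' : ℝ) ≤ E ^ c' := natCast_le_expLogDivLogLog_pow hh c'
  calc ((disjointSolutions k h σ).card : ℝ) * h
      ≤ (((k * (2 * D)) ^ k * ((h * (2 * M + 1)) * (2 * D) ^ k) : ℕ) : ℝ) * h := by
        gcongr
    _ = (k * 2) ^ k * 2 ^ k * (D : ℝ) ^ k * (D : ℝ) ^ k * ((h ^ 2 * (2 * M + 1) : ℕ) : ℝ) := by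
        push_cast; ring
    _ ≤ (k * 2) ^ k * 2 ^ k * (E ^ A₀) ^ k * (E ^ A₀) ^ k *
          (((2 * c + 1) * h ^ k : ℕ) : ℝ) := by gcongr
    _ = (c' : ℝ) * ((E ^ A₀) ^ k * (E ^ A₀) ^ k) * h ^ k := by
        rw [hc']; push_cast; ring
    _ ≤ E ^ c' * ((E ^ A₀) ^ k * (E ^ A₀) ^ k) * h ^ k := by gcongr
    _ = _ := by rw [pow_add, two_mul, pow_add, ← pow_mul]; ring

lemma shiftPoly_eq_mul_removeNth {k : ℕ} (x : Fin (k + 1) → ℤ) (i : Fin (k + 1)) :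
    shiftPoly x = (X + C (x i)) * shiftPoly (i.removeNth x) :=
  Fin.prod_univ_succAbove _ i

lemma removeNth_mem_intBox {k h : ℕ} {x : Fin (k + 1) → ℤ} (hx : x ∈ intBox (k + 1) h)
    (i : Fin (k + 1)) : i.removeNth x ∈ intBox k h :=
  mem_intBox.2 fun j => mem_intBox.1 hx (i.succAbove j)

lemma eq_of_removeNth_eq {k : ℕ} {x y : Fin (k + 1) → ℤ} {i : Fin (k + 1)} (h : x i = y i)
    (h' : i.removeNth x = i.removeNth y) : x = y := by
  rw [← Fin.insertNth_self_removeNth i x, ← Fin.insertNth_self_removeNth i y, h, h']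

lemma intCast_add_ne_zero {σ : ℂ} (hσ : ∀ q : ℚ, (q : ℂ) ≠ σ) (n : ℤ) : (n : ℂ) + σ ≠ 0 :=
  fun h => hσ (-n) (by push_cast; linear_combination -h)

lemma card_nondiagonalSolutions_succ_le {k h : ℕ} {σ : ℂ} (hσ : ∀ q : ℚ, (q : ℂ) ≠ σ) :
    (nondiagonalSolutions (k + 1) h σ).card ≤ (disjointSolutions (k + 1) h σ).card +
      (k + 1) ^ 2 * (h * (nondiagonalSolutions k h σ).card) := by
  classical
  let W : Fin (k + 1) × Fin (k + 1) → Finset ((Fin (k + 1) → ℤ) × (Fin (k + 1) → ℤ)) :=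
    fun a => (nondiagonalSolutions (k + 1) h σ).filter fun p => p.1 a.1 = p.2 a.2
  have hW : ∀ a, (W a).card ≤ h * (nondiagonalSolutions k h σ).card := by
    rintro ⟨i, j⟩
    calc _ ≤ (Finset.Icc (1 : ℤ) h ×ˢ nondiagonalSolutions k h σ).card := by
          refine Finset.card_le_card_of_injOn
            (fun p => (p.1 i, (i.removeNth p.1, j.removeNth p.2))) (fun p hp => ?_) ?_
          · obtain ⟨hp, hij⟩ := Finset.mem_filter.1 hp
            obtain ⟨⟨hx, hy⟩, hne, heq⟩ := mem_nondiagonalSolutions.1 hp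
            simp only at hij
            refine Finset.mem_product.2 ⟨Finset.mem_Icc.2 (mem_intBox.1 hx i),
              mem_nondiagonalSolutions.2
                ⟨⟨removeNth_mem_intBox hx i, removeNth_mem_intBox hy j⟩, ?_, ?_⟩⟩
            · intro h0
              apply hne
              rw [shiftPoly_eq_mul_removeNth p.1 i, shiftPoly_eq_mul_removeNth p.2 j, hij]
              simp only at h0
              rw [h0]
            · rw [shiftPoly_eq_mul_removeNth p.1 i, shiftPoly_eq_mul_removeNth p.2 j, hij,
                map_mul, map_mul] at heq
              refine mul_left_cancel₀ ?_ heq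
              have := intCast_add_ne_zero hσ (p.2 j)
              simpa [add_comm] using this
          · intro p hp r hr hpr
            have hp' : p.1 i = p.2 j := (Finset.mem_filter.1 hp).2
            have hr' : r.1 i = r.2 j := (Finset.mem_filter.1 hr).2
            simp only [Prod.mk.injEq] at hpr
            exact Prod.ext (eq_of_removeNth_eq hpr.1 hpr.2.1)
              (eq_of_removeNth_eq (hp'.symm.trans (hpr.1.trans hr')) hpr.2.2)
      _ = _ := by rw [Finset.card_product, Int.card_Icc]; simp
  have hsub : nondiagonalSolutions (k + 1) h σ ⊆
      disjointSolutions (k + 1) h σ ∪ Finset.univ.biUnion W := by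
    intro p hp
    by_cases hd : ∀ i j, p.1 i ≠ p.2 j
    · exact Finset.mem_union_left _ (mem_disjointSolutions.2 ⟨hp, hd⟩)
    · push Not at hd
      obtain ⟨i, j, hij⟩ := hd
      exact Finset.mem_union_right _ (Finset.mem_biUnion.2
        ⟨(i, j), Finset.mem_univ _, Finset.mem_filter.2 ⟨hp, hij⟩⟩)
  refine (Finset.card_le_card hsub).trans ((Finset.card_union_le _ _).trans ?_)
  gcongr
  refine (Finset.card_biUnion_le_card_mul _ _ _ fun a _ => hW a).trans_eq ?_
  rw [Finset.card_univ, Fintype.card_prod, Fintype.card_fin, ← sq]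

theorem exists_card_nondiagonalSolutions_mul_le (k : ℕ) :
    ∃ A : ℕ, ∀ h : ℕ, 3 ≤ h → ∀ σ : ℂ, (∀ q : ℚ, (q : ℂ) ≠ σ) →
      ((nondiagonalSolutions k h σ).card : ℝ) * h ≤ (h : ℝ) ^ k * expLogDivLogLog h ^ A := by
  induction k with
  | zero =>
    refine ⟨0, fun h hh σ _ => ?_⟩
    have : nondiagonalSolutions 0 h σ = ∅ := by
      refine Finset.eq_empty_of_forall_notMem fun p hp => ?_
      exact (mem_nondiagonalSolutions.1 hp).2.1 (congrArg _ (Subsingleton.elim _ _))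
    simp [this]
  | succ k ih =>
    obtain ⟨A, hA⟩ := ih
    obtain ⟨A', hA'⟩ := exists_card_disjointSolutions_mul_le (k + 1)
    refine ⟨A' + ((k + 1) ^ 2 + A) + 1, fun h hh σ hσ => ?_⟩
    have hE := two_le_expLogDivLogLog hh
    set E := expLogDivLogLog h
    have hE1 : 1 ≤ E := by linarith
    have hE0 : 0 < E := by linarith
    have h1 := card_nondiagonalSolutions_succ_le (k := k) (h := h) hσ
    have h2 : ((((k + 1) ^ 2 : ℕ) : ℝ)) ≤ E ^ ((k + 1) ^ 2) :=
      natCast_le_expLogDivLogLog_pow hh _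
    have h3 : 1 ≤ E ^ A' := one_le_pow₀ hE1
    have h4 : 1 ≤ E ^ ((k + 1) ^ 2 + A) := one_le_pow₀ hE1
    calc ((nondiagonalSolutions (k + 1) h σ).card : ℝ) * h
        ≤ (((disjointSolutions (k + 1) h σ).card +
            (k + 1) ^ 2 * (h * (nondiagonalSolutions k h σ).card) : ℕ) : ℝ) * h := by gcongr
      _ = (disjointSolutions (k + 1) h σ).card * h + (((k + 1) ^ 2 : ℕ) : ℝ) *
            (h * ((nondiagonalSolutions k h σ).card * h)) := by push_cast; ring
      _ ≤ (h : ℝ) ^ (k + 1) * E ^ A' + E ^ ((k + 1) ^ 2) * (h * ((h : ℝ) ^ k * E ^ A)) :=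
        add_le_add (hA' h hh σ hσ) (mul_le_mul h2 (mul_le_mul_of_nonneg_left (hA h hh σ hσ)
          (by positivity)) (by positivity) (by positivity))
      _ = (h : ℝ) ^ (k + 1) * (E ^ A' * 1 + 1 * E ^ ((k + 1) ^ 2 + A)) := by ring
      _ ≤ (h : ℝ) ^ (k + 1) * (E ^ A' * E ^ ((k + 1) ^ 2 + A) +
            E ^ A' * E ^ ((k + 1) ^ 2 + A)) := by gcongr
      _ = (h : ℝ) ^ (k + 1) * (E ^ (A' + ((k + 1) ^ 2 + A)) * 2) := by rw [pow_add]; ring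
      _ ≤ _ := by rw [pow_succ E]; gcongr

lemma exists_perm_eq_comp_of_map_univ_eq {α : Type*} [LinearOrder α] {k : ℕ} {x y : Fin k → α}
    (h : Multiset.map x Finset.univ.val = Multiset.map y Finset.univ.val) :
    ∃ e : Equiv.Perm (Fin k), x ∘ e = y := by
  have key : ∀ z : Fin k → α, (↑(List.ofFn z) : Multiset α) = Multiset.map z Finset.univ.val := by
    intro z
    rw [Fin.univ_val_map]
  have hperm : (List.ofFn (x ∘ Tuple.sort x)).Perm (List.ofFn (y ∘ Tuple.sort y)) := by
    refine (Equiv.Perm.ofFn_comp_perm _ _).trans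
      (List.Perm.trans ?_ (Equiv.Perm.ofFn_comp_perm _ _).symm)
    rw [← Multiset.coe_eq_coe, key, key, h]
  have hs : ∀ z : Fin k → α, (List.ofFn (z ∘ Tuple.sort z)).SortedLE := fun z =>
    (Tuple.monotone_sort z).sortedLE_ofFn
  have heq : x ∘ Tuple.sort x = y ∘ Tuple.sort y :=
    List.ofFn_injective (hperm.eq_of_sortedLE (hs x) (hs y))
  refine ⟨(Tuple.sort y)⁻¹.trans (Tuple.sort x), ?_⟩
  funext i
  have := congrFun heq ((Tuple.sort y)⁻¹ i)
  simpa using this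

lemma shiftPoly_comp_perm {k : ℕ} (x : Fin k → ℤ) (e : Equiv.Perm (Fin k)) :
    shiftPoly (x ∘ e) = shiftPoly x :=
  Equiv.prod_comp e fun i => X + C (x i)

lemma exists_perm_of_shiftPoly_eq {k : ℕ} {x y : Fin k → ℤ} (h : shiftPoly x = shiftPoly y) :
    ∃ e : Equiv.Perm (Fin k), x ∘ e = y := by
  have key : ∀ z : Fin k → ℤ, (shiftPoly z).roots = Multiset.map (-z) Finset.univ.val := by
    intro z
    have : shiftPoly z = (Multiset.map (fun a => X - C a)
        (Multiset.map (-z) Finset.univ.val)).prod := by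
      rw [Multiset.map_map]
      exact congrArg _ (Multiset.map_congr rfl fun i _ => by simp)
    rw [this, roots_multiset_prod_X_sub_C]
  obtain ⟨e, he⟩ := exists_perm_eq_comp_of_map_univ_eq
    (x := -x) (y := -y) (by rw [← key, ← key, h])
  exact ⟨e, funext fun i => neg_injective (congrFun he i)⟩

lemma card_filter_shiftPoly_eq_le {k h : ℕ} (x : Fin k → ℤ) [DecidableEq ℤ[X]] :
    ((intBox k h).filter fun y => shiftPoly x = shiftPoly y).card ≤ k.factorial := by
  classical
  calc _ ≤ (Finset.univ.image fun e : Equiv.Perm (Fin k) => x ∘ e).card := by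
        refine Finset.card_le_card fun y hy => ?_
        obtain ⟨e, he⟩ := exists_perm_of_shiftPoly_eq (Finset.mem_filter.1 hy).2
        exact Finset.mem_image.2 ⟨e, Finset.mem_univ _, he⟩
    _ ≤ _ := Finset.card_image_le.trans_eq (by
        rw [Finset.card_univ, Fintype.card_perm, Fintype.card_fin])

lemma factorial_le_card_filter_shiftPoly_eq {k h : ℕ} {x : Fin k → ℤ} [DecidableEq ℤ[X]]
    (hx : x ∈ intBox k h) (hinj : Function.Injective x) :
    k.factorial ≤ ((intBox k h).filter fun y => shiftPoly x = shiftPoly y).card := by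
  calc k.factorial = (Finset.univ : Finset (Equiv.Perm (Fin k))).card := by
        rw [Finset.card_univ, Fintype.card_perm, Fintype.card_fin]
    _ ≤ _ := by
        refine Finset.card_le_card_of_injOn (fun e => x ∘ e) (fun e _ => ?_) ?_
        · refine Finset.mem_filter.2 ⟨mem_intBox.2 fun i => mem_intBox.1 hx (e i), ?_⟩
          exact (shiftPoly_comp_perm x e).symm
        · intro e _ e' _ hee
          exact Equiv.ext fun i => hinj (congrFun hee i)

lemma card_filter_not_injective_le (k h : ℕ) :
    ((intBox (k + 1) h).filter fun x => ¬ Function.Injective x).card ≤ (k + 1) ^ 2 * h ^ k := by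
  classical
  let W : Fin (k + 1) × Fin (k + 1) → Finset (Fin (k + 1) → ℤ) := fun a =>
    (intBox (k + 1) h).filter fun x => a.1 ≠ a.2 ∧ x a.1 = x a.2
  have hW : ∀ a, (W a).card ≤ h ^ k := by
    rintro ⟨i, j⟩
    rw [← card_intBox]
    refine Finset.card_le_card_of_injOn i.removeNth
      (fun x hx => removeNth_mem_intBox (Finset.mem_filter.1 hx).1 i) fun x hx y hy hxy => ?_
    obtain ⟨-, hij, hxij⟩ := Finset.mem_filter.1 hx
    obtain ⟨-, -, hyij⟩ := Finset.mem_filter.1 hy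
    simp only at hij hxij hyij
    obtain ⟨l, hl⟩ := Fin.exists_succAbove_eq hij.symm
    refine eq_of_removeNth_eq ?_ hxy
    rw [hxij, hyij, ← hl]
    exact congrFun hxy l
  have hsub : ((intBox (k + 1) h).filter fun x => ¬ Function.Injective x) ⊆
      Finset.univ.biUnion W := by
    intro x hx
    obtain ⟨hx, hinj⟩ := Finset.mem_filter.1 hx
    rw [Function.Injective] at hinj
    push Not at hinj
    obtain ⟨i, j, hxij, hij⟩ := hinj
    exact Finset.mem_biUnion.2 ⟨(i, j), Finset.mem_univ _, Finset.mem_filter.2 ⟨hx, hij, hxij⟩⟩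
  refine (Finset.card_le_card hsub).trans ?_
  refine (Finset.card_biUnion_le_card_mul _ _ _ fun a _ => hW a).trans_eq ?_
  rw [Finset.card_univ, Fintype.card_prod, Fintype.card_fin, ← sq]

open Classical in
/-- The solutions whose two sides are permutations of each other. -/
noncomputable def diagonalSolutions (k h : ℕ) : Finset ((Fin k → ℤ) × (Fin k → ℤ)) :=
  (intBox k h ×ˢ intBox k h).filter fun p => shiftPoly p.1 = shiftPoly p.2

lemma card_diagonalSolutions_le (k h : ℕ) :
    (diagonalSolutions k h).card ≤ k.factorial * h ^ k := by
  classical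
  rw [diagonalSolutions, Finset.card_filter, Finset.sum_product, mul_comm, ← card_intBox,
    ← smul_eq_mul]
  refine Finset.sum_le_card_nsmul _ _ _ fun x _ => ?_
  rw [← Finset.card_filter]
  exact card_filter_shiftPoly_eq_le x

lemma le_card_diagonalSolutions_add (k h : ℕ) :
    (k + 1).factorial * h ^ (k + 1) ≤
      (diagonalSolutions (k + 1) h).card + (k + 1).factorial * ((k + 1) ^ 2 * h ^ k) := by
  classical
  have h1 : ((intBox (k + 1) h).filter fun x => Function.Injective x).card * (k + 1).factorial ≤
      (diagonalSolutions (k + 1) h).card := by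
    rw [diagonalSolutions, Finset.card_filter _ (intBox (k + 1) h ×ˢ intBox (k + 1) h),
      Finset.sum_product, ← smul_eq_mul]
    refine le_trans ?_ (Finset.sum_le_sum_of_subset
      (Finset.filter_subset (fun x => Function.Injective x) _))
    refine Finset.card_nsmul_le_sum _ _ _ fun x hx => ?_
    rw [← Finset.card_filter]
    obtain ⟨hx, hinj⟩ := Finset.mem_filter.1 hx
    exact factorial_le_card_filter_shiftPoly_eq hx hinj
  have h2 := Finset.card_filter_add_card_filter_not
    (s := intBox (k + 1) h) (fun x => Function.Injective x)
  rw [card_intBox] at h2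
  have h3 := card_filter_not_injective_le k h
  rw [← h2]
  nlinarith [Nat.factorial_pos (k + 1)]

lemma setOf_solutions_eq {k h : ℕ} {σ : ℂ} (hσ : ∀ q : ℚ, (q : ℂ) ≠ σ) :
    {xy : (Fin k → ℤ) × (Fin k → ℤ) |
      (∀ i, 1 ≤ xy.1 i ∧ xy.1 i ≤ (h : ℤ)) ∧ (∀ i, 1 ≤ xy.2 i ∧ xy.2 i ≤ (h : ℤ)) ∧
      (∏ i, ((xy.1 i : ℂ) + σ)) = (∏ i, ((xy.2 i : ℂ) + σ)) ∧
      (∏ i, ((xy.1 i : ℂ) + σ)) ≠ 0} =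
    ((diagonalSolutions k h).disjUnion (nondiagonalSolutions k h σ) (by
      rw [Finset.disjoint_left]
      intro p hp hp'
      exact (mem_nondiagonalSolutions.1 hp').2.1 (Finset.mem_filter.1 hp).2) :
        Finset ((Fin k → ℤ) × (Fin k → ℤ))) := by
  ext p
  simp only [Set.mem_ofPred_eq, Finset.mem_coe, Finset.mem_disjUnion, diagonalSolutions,
    Finset.mem_filter, Finset.mem_product, mem_nondiagonalSolutions, ← mem_intBox,
    ← aeval_shiftPoly]
  have h0 : aeval σ (shiftPoly p.1) ≠ 0 := by
    rw [aeval_shiftPoly]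
    exact Finset.prod_ne_zero_iff.2 fun i _ => intCast_add_ne_zero hσ _
  by_cases heq : shiftPoly p.1 = shiftPoly p.2
  · rw [heq] at h0
    simp [heq, h0]
  · simp [heq, h0, and_assoc]

/-- For fixed `ν ≥ 1` there is `C = C(ν) > 0` such that for every `h ≥ 3` and every
irrational `σ ∈ ℂ` one has `|K_ν(h,σ) − ν!·h^ν| ≤ h^{ν−1} exp(C log h / log log h)`. -/
theorem stmt3 (ν : ℕ) (hν : 1 ≤ ν) :
    ∃ C : ℝ, 0 < C ∧ ∀ h : ℕ, 3 ≤ h → ∀ σ : ℂ, (∀ q : ℚ, (q : ℂ) ≠ σ) →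
      |(Set.ncard {xy : (Fin ν → ℤ) × (Fin ν → ℤ) |
          (∀ i, 1 ≤ xy.1 i ∧ xy.1 i ≤ (h : ℤ)) ∧
          (∀ i, 1 ≤ xy.2 i ∧ xy.2 i ≤ (h : ℤ)) ∧
          (∏ i, ((xy.1 i : ℂ) + σ)) = (∏ i, ((xy.2 i : ℂ) + σ)) ∧
          (∏ i, ((xy.1 i : ℂ) + σ)) ≠ 0} : ℝ) - (Nat.factorial ν : ℝ) * (h : ℝ) ^ ν|
        ≤ (h : ℝ) ^ (ν - 1) * Real.exp (C * Real.log h / Real.log (Real.log h)) := by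
  obtain ⟨k, rfl⟩ : ∃ k, ν = k + 1 := ⟨ν - 1, by omega⟩
  obtain ⟨A, hA⟩ := exists_card_nondiagonalSolutions_mul_le (k + 1)
  set c : ℕ := (k + 1).factorial * (k + 1) ^ 2 with hc
  refine ⟨((A + c + 1 : ℕ) : ℝ), by positivity, fun h hh σ hσ => ?_⟩
  have hexp : Real.exp (((A + c + 1 : ℕ) : ℝ) * Real.log h / Real.log (Real.log h)) =
      expLogDivLogLog h ^ (A + c + 1) := by
    rw [expLogDivLogLog, ← Real.exp_nat_mul, mul_div_assoc]
  rw [hexp, setOf_solutions_eq hσ, Set.ncard_coe_finset, Finset.card_disjUnion, Nat.cast_add,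
    Nat.add_sub_cancel]
  have hE := two_le_expLogDivLogLog hh
  have hcE := natCast_le_expLogDivLogLog_pow hh c
  have hAσ := hA h hh σ hσ
  set E := expLogDivLogLog h
  have hE1 : 1 ≤ E := by linarith
  have hh0 : (0 : ℝ) < h := by positivity
  have hnd : ((nondiagonalSolutions (k + 1) h σ).card : ℝ) ≤ (h : ℝ) ^ k * E ^ A := by
    refine le_of_mul_le_mul_right (hAσ.trans_eq ?_) hh0
    ring
  have hup : ((diagonalSolutions (k + 1) h).card : ℝ) ≤ (k + 1).factorial * (h : ℝ) ^ (k + 1) := by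
    exact_mod_cast card_diagonalSolutions_le (k + 1) h
  have hlow : ((k + 1).factorial : ℝ) * (h : ℝ) ^ (k + 1) ≤
      (diagonalSolutions (k + 1) h).card + (h : ℝ) ^ k * c := by
    have := le_card_diagonalSolutions_add k h
    rw [← mul_assoc, ← hc, mul_comm c] at this
    exact_mod_cast this
  have hnd0 : (0 : ℝ) ≤ (nondiagonalSolutions (k + 1) h σ).card := by positivity
  have hA1 : E ^ A ≤ E ^ (A + c + 1) := pow_le_pow_right₀ hE1 (by omega)
  have hc1 : (c : ℝ) ≤ E ^ (A + c + 1) := hcE.trans (pow_le_pow_right₀ hE1 (by omega))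
  have hA2 := mul_le_mul_of_nonneg_left hA1 (show (0 : ℝ) ≤ (h : ℝ) ^ k by positivity)
  have hc2 := mul_le_mul_of_nonneg_left hc1 (show (0 : ℝ) ≤ (h : ℝ) ^ k by positivity)
  rw [abs_le]
  constructor <;> linarith
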